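/- arXiv:math/0110314 — 2 statements merged into one kernel-verified Lean document; each statement's English description precedes it below -/
import Mathlib

section
/- Let n, p, q be natural numbers with n ≤ p, n ≤ q, and set m = p + q − n. A strictly increasing tuple 0 ≤ i_0 < i_1 < ⋯ < i_n ≤ m satisfies onesPlus(i) = q − n and onesMinus(i) = p − n if and only if i_0 = Σ_{k=1}^{n} (−1)^{k+1} i_k + (−1)^{n}(λ(n) − ⌊n/2⌋), i.e. if and only if i_0 = S(0). (For n even this reads i_0 = i_1 − i_2 + i_3 − ⋯ − i_n + p − n/2, which is equation (5) of the paper.) -/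
/-- The value `i_t` of an index tuple `0 ≤ i_0 < i_1 < ⋯ < i_n ≤ m`, regarded as a
strictly monotone function `Fin (n+1) → Fin (m+1)`, extended by `0` outside range. -/
def ival (n m : ℕ) (i : Fin (n + 1) → Fin (m + 1)) (t : ℕ) : ℕ :=
  if h : t ≤ n then (i ⟨t, Nat.lt_succ_of_le h⟩ : ℕ) else 0

/-- Block lengths of the word `(i_0,…,i_n)_m`: `b_0 = i_0`,
`b_j = i_j − i_{j−1} − 1` for `1 ≤ j ≤ n`, and `b_{n+1} = m − i_n`. -/
def blockLen (n m : ℕ) (i : Fin (n + 1) → Fin (m + 1)) (j : ℕ) : ℕ :=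
  if j = 0 then ival n m i 0
  else if j ≤ n then ival n m i j - ival n m i (j - 1) - 1
  else m - ival n m i n

/-- The number of letters `1` in the word `(i_0,…,i_n)_m^+`: the sum of the
block lengths `b_j` over odd `j` with `0 ≤ j ≤ n+1`. -/
def onesPlus (n m : ℕ) (i : Fin (n + 1) → Fin (m + 1)) : ℕ :=
  ∑ j ∈ Finset.range (n + 2), if Odd j then blockLen n m i j else 0

/-- The number of letters `1` in the word `(i_0,…,i_n)_m^-`: the sum of the
block lengths `b_j` over even `j` with `0 ≤ j ≤ n+1`. -/
def onesMinus (n m : ℕ) (i : Fin (n + 1) → Fin (m + 1)) : ℕ :=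
  ∑ j ∈ Finset.range (n + 2), if Even j then blockLen n m i j else 0

/-- The lower bound `S(k) = Σ_{t=k+1}^{n} (−1)^{t−k−1} i_t + (−1)^{k+n}(λ(n) − ⌊n/2⌋) + ⌊k/2⌋`,
where `λ(n) = p` if `n` is even and `λ(n) = q` if `n` is odd. -/
def cupS (n p q m : ℕ) (i : Fin (n + 1) → Fin (m + 1)) (k : ℕ) : ℤ :=
  (∑ t ∈ Finset.Icc (k + 1) n, (-1 : ℤ) ^ (t - k - 1) * (ival n m i t : ℤ))
    + (-1 : ℤ) ^ (k + n) * ((if Even n then (p : ℤ) else (q : ℤ)) - ((n / 2 : ℕ) : ℤ))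
    + ((k / 2 : ℕ) : ℤ)

theorem ival_lt_ival_succ {n m : ℕ} {i : Fin (n + 1) → Fin (m + 1)} (hi : StrictMono i)
    {N : ℕ} (hN : N + 1 ≤ n) : ival n m i N < ival n m i (N + 1) := by
  have h : N ≤ n := by omega
  simp only [ival, dif_pos h, dif_pos hN]
  exact hi (Fin.mk_lt_mk.2 N.lt_succ_self)

theorem ival_le (n m : ℕ) (i : Fin (n + 1) → Fin (m + 1)) (t : ℕ) : ival n m i t ≤ m := by
  unfold ival
  split_ifs
  · exact Nat.le_of_lt_succ (Fin.is_lt _)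
  · exact Nat.zero_le m

theorem blockLen_succ {n m : ℕ} {i : Fin (n + 1) → Fin (m + 1)} (hi : StrictMono i)
    {N : ℕ} (hN : N + 1 ≤ n) :
    (blockLen n m i (N + 1) : ℤ) = ival n m i (N + 1) - ival n m i N - 1 := by
  have h := ival_lt_ival_succ hi hN
  simp only [blockLen, Nat.succ_ne_zero, if_false, if_pos hN, Nat.add_sub_cancel]
  omega

theorem blockLen_last (n m : ℕ) (i : Fin (n + 1) → Fin (m + 1)) :
    (blockLen n m i (n + 1) : ℤ) = m - ival n m i n := by
  have h := ival_le n m i n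
  simp only [blockLen, Nat.succ_ne_zero, if_false, Nat.not_succ_le_self]
  omega

/-- The even and odd partial sums of the block lengths, expressed by the alternating sum of the
entries of the tuple. -/
theorem partial_sums_blockLen {n m : ℕ} {i : Fin (n + 1) → Fin (m + 1)} (hi : StrictMono i)
    {N : ℕ} (hN : N ≤ n) :
    ((∑ j ∈ Finset.range (N + 1), if Even j then blockLen n m i j else 0 : ℕ) : ℤ)
        + (∑ j ∈ Finset.range (N + 1), if Odd j then blockLen n m i j else 0 : ℕ)
      = ival n m i N - N ∧
    (Even N → ((∑ j ∈ Finset.range (N + 1), if Even j then blockLen n m i j else 0 : ℕ) : ℤ)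
      = ∑ t ∈ Finset.range (N + 1), (-1 : ℤ) ^ t * ival n m i t - (N / 2 : ℕ)) ∧
    (Odd N → ((∑ j ∈ Finset.range (N + 1), if Odd j then blockLen n m i j else 0 : ℕ) : ℤ)
      = -∑ t ∈ Finset.range (N + 1), (-1 : ℤ) ^ t * ival n m i t - ((N + 1) / 2 : ℕ)) := by
  induction N with
  | zero => simp [blockLen]
  | succ N ih =>
    obtain ⟨hsum, heven, hodd⟩ := ih (by omega)
    have hb := blockLen_succ hi hN
    rw [Finset.sum_range_succ _ (N + 1), Finset.sum_range_succ _ (N + 1),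
      Finset.sum_range_succ _ (N + 1)]
    rcases Nat.even_or_odd N with h | h
    · have h1 : Odd (N + 1) := h.add_one
      have h2 : ¬ Even (N + 1) := Nat.not_even_iff_odd.2 h1
      have h3 := heven h
      rw [if_neg h2, if_pos h1, h1.neg_one_pow]
      obtain ⟨r, rfl⟩ := h
      refine ⟨by push_cast at *; linarith, fun h => absurd h h2, fun _ => ?_⟩
      push_cast at *
      omega
    · have h1 : Even (N + 1) := h.add_one
      have h2 : ¬ Odd (N + 1) := Nat.not_odd_iff_even.2 h1
      have h3 := hodd h
      rw [if_pos h1, if_neg h2, h1.neg_one_pow]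
      obtain ⟨r, rfl⟩ := h
      refine ⟨by push_cast at *; linarith, fun _ => ?_, fun h => absurd h h2⟩
      push_cast at *
      omega

theorem sum_Icc_one_neg_one_pow_mul (a : ℕ → ℤ) (n : ℕ) :
    ∑ t ∈ Finset.Icc 1 n, (-1 : ℤ) ^ (t - 1) * a t
      = a 0 - ∑ t ∈ Finset.range (n + 1), (-1 : ℤ) ^ t * a t := by
  induction n with
  | zero => simp
  | succ n ih =>
    rw [Finset.sum_Icc_succ_top (by omega), ih, Finset.sum_range_succ _ (n + 1),
      Nat.add_sub_cancel, pow_succ]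
    ring

/-- A strictly increasing tuple `0 ≤ i_0 < ⋯ < i_n ≤ m` (with `m = p + q − n`,
`n ≤ p`, `n ≤ q`) satisfies `onesPlus(i) = q − n` and `onesMinus(i) = p − n`
if and only if `i_0 = S(0)`. -/
theorem onesPlus_and_onesMinus_iff (n p q m : ℕ) (hnp : n ≤ p) (hnq : n ≤ q)
    (hm : m = p + q - n) (i : Fin (n + 1) → Fin (m + 1)) (hi : StrictMono i) :
    (onesPlus n m i = q - n ∧ onesMinus n m i = p - n) ↔
      (ival n m i 0 : ℤ) = cupS n p q m i 0 := by
  obtain ⟨hsum, heven, hodd⟩ := partial_sums_blockLen hi le_rfl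
  have hl := blockLen_last n m i
  have hS := sum_Icc_one_neg_one_pow_mul (fun t => (ival n m i t : ℤ)) n
  simp only [onesPlus, onesMinus, cupS, Nat.sub_zero, Nat.zero_add, Nat.zero_div]
  rw [hS, Finset.sum_range_succ _ (n + 1), Finset.sum_range_succ _ (n + 1)]
  rcases Nat.even_or_odd n with h | h
  · have h1 : Odd (n + 1) := h.add_one
    have h2 : ¬ Even (n + 1) := Nat.not_even_iff_odd.2 h1
    have h3 := heven h
    rw [if_neg h2, if_pos h1, if_pos h, h.neg_one_pow]
    have h4 := Nat.even_iff.1 h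
    omega
  · have h1 : Even (n + 1) := h.add_one
    have h2 : ¬ Odd (n + 1) := Nat.not_odd_iff_even.2 h1
    have h3 := hodd h
    rw [if_pos h1, if_neg h2, if_neg (Nat.not_even_iff_odd.2 h), h.neg_one_pow]
    have h4 := Nat.odd_iff.1 h
    omega
end

section
/- (Number of summands in the refined cup-n formula.) Let n, p, q be natural numbers with n ≤ p, n ≤ q, and set m = p + q − n. The number of strictly increasing tuples 0 ≤ i_0 < i_1 < ⋯ < i_n ≤ m satisfying onesPlus(i) = q − n and onesMinus(i) = p − n equals the product of binomial coefficients C(q − ⌊(n+1)/2⌋, ⌊n/2⌋) · C(p − ⌊n/2⌋, ⌊(n+1)/2⌋). -/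
theorem ival_of_le {n m : ℕ} (i : Fin (n + 1) → Fin (m + 1)) {t : ℕ} (h : t ≤ n) :
    ival n m i t = i ⟨t, Nat.lt_succ_of_le h⟩ :=
  dif_pos h

/-- A strictly increasing tuple is recovered from the partial sums of its block lengths. -/
theorem sum_range_blockLen_add {n m : ℕ} {i : Fin (n + 1) → Fin (m + 1)} (hi : StrictMono i)
    {t : ℕ} (ht : t ≤ n) :
    ∑ j ∈ Finset.range (t + 1), blockLen n m i j + t = ival n m i t := by
  induction t with
  | zero => simp [blockLen]
  | succ t ih =>
    have hlt : ival n m i t < ival n m i (t + 1) := by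
      rw [ival_of_le i ht, ival_of_le i (t.le_succ.trans ht)]
      exact hi (Fin.mk_lt_mk.2 t.lt_succ_self)
    have hb : blockLen n m i (t + 1) = ival n m i (t + 1) - ival n m i t - 1 := by
      simp [blockLen, ht]
    have := ih (t.le_succ.trans ht)
    rw [Finset.sum_range_succ, hb]
    lia

theorem eq_of_blockLen_eq {n m : ℕ} {i i' : Fin (n + 1) → Fin (m + 1)} (hi : StrictMono i)
    (hi' : StrictMono i') (h : ∀ j < n + 2, blockLen n m i j = blockLen n m i' j) : i = i' := by
  ext ⟨t, ht⟩
  have ht' : t ≤ n := Nat.le_of_lt_succ ht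
  rw [← ival_of_le i ht', ← ival_of_le i' ht', ← sum_range_blockLen_add hi ht',
    ← sum_range_blockLen_add hi' ht']
  congr 1
  refine Finset.sum_congr rfl fun j hj => h j ?_
  have := Finset.mem_range.1 hj
  lia

/-- Every sequence of `n + 2` block lengths with the right total comes from a tuple. -/
theorem exists_strictMono_blockLen_eq {n m : ℕ} (b : ℕ → ℕ)
    (hb : ∑ j ∈ Finset.range (n + 2), b j + n = m) :
    ∃ i : Fin (n + 1) → Fin (m + 1), StrictMono i ∧ ∀ j < n + 2, blockLen n m i j = b j := by
  have hmono : StrictMono fun t => ∑ j ∈ Finset.range (t + 1), b j + t :=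
    strictMono_nat_of_lt_succ fun t => by
      rw [Finset.sum_range_succ _ (t + 1)]
      lia
  have hle : ∀ t ≤ n, ∑ j ∈ Finset.range (t + 1), b j + t < m + 1 := fun t ht => by
    have := hmono.monotone ht
    rw [Finset.sum_range_succ] at hb
    lia
  let i : Fin (n + 1) → Fin (m + 1) := fun t =>
    ⟨∑ j ∈ Finset.range (t + 1), b j + t, hle t (Nat.le_of_lt_succ t.2)⟩
  have hival : ∀ t ≤ n, ival n m i t = ∑ j ∈ Finset.range (t + 1), b j + t := fun t ht =>
    ival_of_le i ht
  refine ⟨i, fun s t hst => Fin.mk_lt_mk.2 (hmono hst), fun j hj => ?_⟩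
  rcases j with _ | j
  · simp [blockLen, hival]
  by_cases hjn : j + 1 ≤ n
  · simp only [blockLen, Nat.add_one_ne_zero, if_false, hjn, if_true, Nat.add_sub_cancel]
    rw [hival _ hjn, hival _ (by lia), Finset.sum_range_succ _ (j + 1)]
    lia
  · obtain rfl : j = n := by lia
    simp only [blockLen, Nat.add_one_ne_zero, if_false, hjn]
    rw [hival _ le_rfl]
    rw [Finset.sum_range_succ] at hb
    lia

theorem card_piAntidiag_nat_eq_choose {ι : Type*} [DecidableEq ι] (s : Finset ι) (n : ℕ) :
    (s.piAntidiag n).card = (s.card + n - 1).choose n := by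
  rw [← Finset.card_finsuppAntidiag_nat_eq_choose, Finset.finsuppAntidiag, Finset.card_map,
    Finset.card_attach]

theorem card_filter_odd_range (n : ℕ) : ((Finset.range n).filter Odd).card = n / 2 := by
  induction n with
  | zero => rfl
  | succ n ih =>
    rw [Finset.range_add_one, Finset.filter_insert]
    split_ifs with h
    · rw [Finset.card_insert_of_notMem (by simp), ih]
      grind
    · rw [ih]
      grind

theorem card_filter_even_range (n : ℕ) :
    ((Finset.range n).filter Even).card = (n + 1) / 2 := by
  have h := Finset.card_filter_add_card_filter_not (s := Finset.range n) Odd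
  simp only [Nat.not_odd_iff_even, card_filter_odd_range, Finset.card_range] at h
  lia

/-- The number of strictly increasing tuples `0 ≤ i_0 < ⋯ < i_n ≤ m`
(with `m = p + q − n`, `n ≤ p`, `n ≤ q`) satisfying `onesPlus(i) = q − n` and
`onesMinus(i) = p − n`, i.e. the number of summands in the refined formula for
the cup-`n` product of a `p`-cochain and a `q`-cochain, is
`C(q − ⌊(n+1)/2⌋, ⌊n/2⌋) · C(p − ⌊n/2⌋, ⌊(n+1)/2⌋)`. -/
theorem card_cupn_summands (n p q m : ℕ) (hnp : n ≤ p) (hnq : n ≤ q)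
    (hm : m = p + q - n) :
    Nat.card {i : Fin (n + 1) → Fin (m + 1) // StrictMono i ∧
        onesPlus n m i = q - n ∧ onesMinus n m i = p - n} =
      Nat.choose (q - (n + 1) / 2) (n / 2) * Nat.choose (p - n / 2) ((n + 1) / 2) := by
  classical
  set S := (Finset.range (n + 2)).filter Odd with hS
  set T := (Finset.range (n + 2)).filter Even with hT
  have hcard : Nat.card {i : Fin (n + 1) → Fin (m + 1) // StrictMono i ∧
      onesPlus n m i = q - n ∧ onesMinus n m i = p - n} =
      (S.piAntidiag (q - n) ×ˢ T.piAntidiag (p - n)).card := by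
    rw [Nat.card_eq_fintype_card, Fintype.card_subtype]
    refine Finset.card_nbij
      (fun i => (fun j => if j ∈ S then blockLen n m i j else 0,
        fun j => if j ∈ T then blockLen n m i j else 0)) ?_ ?_ ?_
    · intro i hi
      obtain ⟨-, hplus, hminus⟩ := (Finset.mem_filter.1 hi).2
      simp only [Finset.coe_product, Set.mem_prod, Finset.mem_coe, Finset.mem_piAntidiag]
      refine ⟨⟨?_, by simp +contextual⟩, ?_, by simp +contextual⟩
      · rw [← hplus, onesPlus, ← Finset.sum_filter Odd]
        exact Finset.sum_congr rfl fun j hj => if_pos hj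
      · rw [← hminus, onesMinus, ← Finset.sum_filter Even]
        exact Finset.sum_congr rfl fun j hj => if_pos hj
    · intro i hi i' hi' h
      refine eq_of_blockLen_eq (Finset.mem_filter.1 hi).2.1 (Finset.mem_filter.1 hi').2.1
        fun j hj => ?_
      obtain ⟨hodd, heven⟩ := Prod.mk.inj h
      rcases Nat.even_or_odd j with hj' | hj'
      · simpa [hT, hj, hj'] using congrFun heven j
      · simpa [hS, hj, hj'] using congrFun hodd j
    · rintro ⟨f, g⟩ hfg
      obtain ⟨⟨hf, hfS⟩, hg, hgT⟩ :
          (S.sum f = q - n ∧ ∀ j, f j ≠ 0 → j ∈ S) ∧ T.sum g = p - n ∧ ∀ j, g j ≠ 0 → j ∈ T := by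
        simpa only [Finset.coe_product, Finset.mem_coe, Set.mem_prod, Finset.mem_piAntidiag]
          using hfg
      have hsum : ∑ j ∈ Finset.range (n + 2), (if Odd j then f j else g j) + n = m := by
        rw [Finset.sum_ite]
        simp only [Nat.not_odd_iff_even]
        rw [← hS, ← hT, hf, hg]
        lia
      obtain ⟨i, hi, hb⟩ := exists_strictMono_blockLen_eq _ hsum
      have hbS : ∀ j ∈ S, blockLen n m i j = f j := fun j hj => by
        obtain ⟨hj, hodd⟩ := Finset.mem_filter.1 hj
        rw [hb j (Finset.mem_range.1 hj), if_pos hodd]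
      have hbT : ∀ j ∈ T, blockLen n m i j = g j := fun j hj => by
        obtain ⟨hj, heven⟩ := Finset.mem_filter.1 hj
        rw [hb j (Finset.mem_range.1 hj), if_neg (Nat.not_odd_iff_even.2 heven)]
      refine ⟨i, ?_, ?_⟩
      · simp only [Finset.coe_filter, Finset.mem_univ, true_and, Set.mem_ofPred_eq]
        refine ⟨hi, ?_, ?_⟩
        · rw [onesPlus, ← Finset.sum_filter, ← hf]
          exact Finset.sum_congr rfl hbS
        · rw [onesMinus, ← Finset.sum_filter, ← hg]
          exact Finset.sum_congr rfl hbT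
      · ext j
        · grind
        · grind
  rw [hcard, Finset.card_product, card_piAntidiag_nat_eq_choose, card_piAntidiag_nat_eq_choose,
    card_filter_odd_range, card_filter_even_range]
  congr 1
  · rw [← Nat.choose_symm_of_eq_add (a := q - n) (b := n / 2) (by lia)]
    congr 1
    lia
  · rw [← Nat.choose_symm_of_eq_add (a := p - n) (b := (n + 1) / 2) (by lia)]
    congr 1
    lia
end
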